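/- arXiv:2002.00836 — 5 statements merged into one kernel-verified Lean document; each statement's English description precedes it below -/
import Mathlib

section
/- Let G = (U,A) be a finite simple graph in which every vertex has degree exactly d for some integer d ≥ 1, and let κ be an integer with 1 ≤ κ ≤ |U|. Consider the approval election with candidate set C = U ∪ {p}, where p ∉ U, and whose votes are: for each edge {u,u'} ∈ A one vote {u,u'}, together with d−1 votes each equal to {p}. Then p belongs to no winning κ-committee under CCAV if and only if G has an independent set of size κ. -/
namespace ApprovalBribery

variable {α : Type*} [DecidableEq α]

/-- AV score of a candidate: number of votes approving it. -/
def avScore (V : Multiset (Finset α)) (c : α) : ℕ :=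
  (V.map fun v => if c ∈ v then 1 else 0).sum

/-- AV score of a committee. -/
def avCom (V : Multiset (Finset α)) (w : Finset α) : ℕ :=
  (V.map fun v => (v ∩ w).card).sum

/-- SAV score of a candidate. -/
def savScore (V : Multiset (Finset α)) (c : α) : ℚ :=
  (V.map fun v => if c ∈ v then ((v.card : ℚ))⁻¹ else 0).sum

/-- NSAV score of a candidate in an election with candidate set `C`. -/
def nsavScore (C : Finset α) (V : Multiset (Finset α)) (c : α) : ℚ :=
  savScore V c -
    (V.map fun v => if c ∉ v ∧ v ≠ C then ((C.card : ℚ) - (v.card : ℚ))⁻¹ else 0).sum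

/-- SAV score of a committee. -/
def savCom (V : Multiset (Finset α)) (w : Finset α) : ℚ :=
  (V.map fun v => ((v ∩ w).card : ℚ) / (v.card : ℚ)).sum

/-- CCAV score of a committee. -/
def ccavCom (V : Multiset (Finset α)) (w : Finset α) : ℕ :=
  (V.map fun v => if v ∩ w ≠ ∅ then 1 else 0).sum

/-- PAV score of a committee. -/
def pavCom (V : Multiset (Finset α)) (w : Finset α) : ℚ :=
  (V.map fun v => ∑ i ∈ Finset.range (v ∩ w).card, ((i : ℚ) + 1)⁻¹).sum

/-- `w` is a winning `k`-committee for the scoring function `score` in an election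
with candidate set `C`. -/
def IsWinningCommittee {β : Type*} [Preorder β] (C : Finset α) (k : ℕ)
    (score : Finset α → β) (w : Finset α) : Prop :=
  w ⊆ C ∧ w.card = k ∧ ∀ w' ⊆ C, w'.card = k → score w' ≤ score w

/-- `V'` is obtained from `V` by performing at most `ℓ` single approval additions,
each of which inserts one candidate of `C` into one vote not already containing it. -/
def ApprovalAdds (C : Finset α) (V V' : Multiset (Finset α)) (ℓ : ℕ) : Prop :=
  ∃ P : Multiset (Finset α × Finset α),
    V = P.map Prod.fst ∧ V' = P.map Prod.snd ∧
    (∀ q ∈ P, q.1 ⊆ q.2 ∧ q.2 ⊆ C) ∧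
    (P.map fun q => (q.2 \ q.1).card).sum ≤ ℓ

/-- `V'` is obtained from `V` by performing at most `ℓ` single approval deletions,
each of which removes one candidate from one vote containing it. -/
def ApprovalDels (V V' : Multiset (Finset α)) (ℓ : ℕ) : Prop :=
  ∃ P : Multiset (Finset α × Finset α),
    V = P.map Prod.fst ∧ V' = P.map Prod.snd ∧
    (∀ q ∈ P, q.2 ⊆ q.1) ∧
    (P.map fun q => (q.1 \ q.2).card).sum ≤ ℓ

/-- `V'` is obtained from `V` by selecting at most `ℓ` votes and replacing each selected
vote by an arbitrary vote over `C` within Hamming distance `r` of it. -/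
def VoteChanges (C : Finset α) (V V' : Multiset (Finset α)) (ℓ r : ℕ) : Prop :=
  ∃ P : Multiset (Finset α × Finset α),
    V = P.map Prod.fst ∧ V' = P.map Prod.snd ∧
    (∀ q ∈ P, q.1 = q.2 ∨ (q.2 ⊆ C ∧ (q.1 \ q.2).card + (q.2 \ q.1).card ≤ r)) ∧
    P.countP (fun q => q.1 ≠ q.2) ≤ ℓ

/-- `V'` is obtained from `V` by selecting at most `ℓ` votes and replacing each selected
vote `v` by a vote `v'` with `v ⊆ v' ⊆ C` and `|v' \ v| ≤ r`. -/
def VoteAdditionChanges (C : Finset α) (V V' : Multiset (Finset α)) (ℓ r : ℕ) : Prop :=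
  ∃ P : Multiset (Finset α × Finset α),
    V = P.map Prod.fst ∧ V' = P.map Prod.snd ∧
    (∀ q ∈ P, q.1 = q.2 ∨ (q.1 ⊆ q.2 ∧ q.2 ⊆ C ∧ (q.2 \ q.1).card ≤ r)) ∧
    P.countP (fun q => q.1 ≠ q.2) ≤ ℓ

/-- `V'` is obtained from `V` by selecting at most `ℓ` votes and replacing each selected
vote `v` by a vote `v'` with `v' ⊆ v` and `|v \ v'| ≤ r`. -/
def VoteDeletionChanges (V V' : Multiset (Finset α)) (ℓ r : ℕ) : Prop :=
  ∃ P : Multiset (Finset α × Finset α),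
    V = P.map Prod.fst ∧ V' = P.map Prod.snd ∧
    (∀ q ∈ P, q.1 = q.2 ∨ (q.2 ⊆ q.1 ∧ (q.1 \ q.2).card ≤ r)) ∧
    P.countP (fun q => q.1 ≠ q.2) ≤ ℓ

/-- `(X, 𝒞)` is an RX3C instance with `|X| = 3κ`: `𝒞` is a collection of `3κ` many
3-element subsets of `X` and every element of `X` belongs to exactly three members of `𝒞`. -/
def IsRX3C (X : Finset α) (𝒞 : Finset (Finset α)) (κ : ℕ) : Prop :=
  X.card = 3 * κ ∧ 𝒞.card = 3 * κ ∧ (∀ H ∈ 𝒞, H ⊆ X ∧ H.card = 3) ∧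
  ∀ x ∈ X, (𝒞.filter fun H => x ∈ H).card = 3

/-- `𝒞` contains an exact cover of `X`: a subcollection `𝒞' ⊆ 𝒞` such that every element
of `X` belongs to exactly one member of `𝒞'`. -/
def HasExactCover (X : Finset α) (𝒞 : Finset (Finset α)) : Prop :=
  ∃ 𝒞' ⊆ 𝒞, ∀ x ∈ X, (𝒞'.filter fun H => x ∈ H).card = 1


section Coverage

variable {U : Type*} [Fintype U] [DecidableEq U] (G : SimpleGraph U) [DecidableRel G.Adj]

/-- The edges of `G` with at least one endpoint in `T`. -/
def coveredEdges (T : Finset U) : Finset (Sym2 U) :=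
  T.biUnion fun a => G.incidenceFinset a

lemma ccavCom_edgeVotes_add_replicate (m : ℕ) (w : Finset (U ⊕ Unit)) :
    ccavCom
      (G.edgeFinset.val.map
          (fun e => (Finset.univ.filter (· ∈ e)).image (Sum.inl : U → U ⊕ Unit))
        + Multiset.replicate m {(Sum.inr () : U ⊕ Unit)}) w
    = (coveredEdges G w.toLeft).card + if Sum.inr () ∈ w then m else 0 := by
  unfold ccavCom
  rw [Multiset.map_add, Multiset.sum_add, Multiset.map_map, Multiset.map_replicate,
    Multiset.sum_replicate]
  congr 1
  · change ∑ e ∈ G.edgeFinset, _ = _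
    simp only [Function.comp_apply]
    rw [Finset.sum_boole, Nat.cast_id]
    congr 1
    ext e
    simp only [coveredEdges, Finset.mem_filter, Finset.mem_biUnion, Finset.mem_toLeft,
      SimpleGraph.mem_incidenceFinset, SimpleGraph.incidenceSet, Set.mem_sep_iff,
      SimpleGraph.mem_edgeFinset, ← Finset.nonempty_iff_ne_empty, Finset.Nonempty,
      Finset.mem_inter, Finset.mem_image, Finset.mem_univ, true_and]
    constructor
    · rintro ⟨he, _, ⟨a, ha, rfl⟩, hw⟩
      exact ⟨a, hw, he, ha⟩
    · rintro ⟨a, hw, he, ha⟩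
      exact ⟨he, _, ⟨a, ha, rfl⟩, hw⟩
  · by_cases h : Sum.inr () ∈ w <;> simp [h]

variable {G} {d : ℕ}

lemma card_coveredEdges_le (hreg : G.IsRegularOfDegree d) (T : Finset U) :
    (coveredEdges G T).card ≤ T.card * d :=
  Finset.card_biUnion_le_card_mul _ _ _ fun a _ => by
    rw [G.card_incidenceFinset_eq_degree, hreg a]

lemma card_coveredEdges_of_indep (hreg : G.IsRegularOfDegree d) {T : Finset U}
    (hT : ∀ a ∈ T, ∀ b ∈ T, ¬ G.Adj a b) :
    (coveredEdges G T).card = T.card * d := by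
  rw [coveredEdges, Finset.card_biUnion]
  · simp [G.card_incidenceFinset_eq_degree, hreg.degree_eq]
  · intro a ha b hb hab
    rw [Function.onFun, Finset.disjoint_left]
    intro e hea heb
    rw [SimpleGraph.mem_incidenceFinset] at hea heb
    exact hT a ha b hb (G.adj_of_mem_incidenceSet hab hea heb)

lemma card_coveredEdges_le_erase (hreg : G.IsRegularOfDegree d) {T : Finset U} {a b : U}
    (ha : a ∈ T) (hb : b ∈ T) (hab : G.Adj a b) :
    (coveredEdges G T).card ≤ (coveredEdges G (T.erase a)).card + (d - 1) := by
  have hsub : coveredEdges G T ⊆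
      coveredEdges G (T.erase a) ∪ (G.incidenceFinset a).erase s(a, b) := by
    intro e he
    obtain ⟨c, hc, hce⟩ := Finset.mem_biUnion.1 he
    by_cases hca : c = a
    · subst hca
      by_cases heb : e = s(c, b)
      · refine Finset.mem_union_left _ (Finset.mem_biUnion.2
          ⟨b, Finset.mem_erase.2 ⟨hab.ne', hb⟩, ?_⟩)
        rw [SimpleGraph.mem_incidenceFinset, heb]
        exact ⟨hab, by simp⟩
      · exact Finset.mem_union_right _ (Finset.mem_erase.2 ⟨heb, hce⟩)
    · exact Finset.mem_union_left _ (Finset.mem_biUnion.2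
        ⟨c, Finset.mem_erase.2 ⟨hca, hc⟩, hce⟩)
  have hmem : s(a, b) ∈ G.incidenceFinset a := by
    rw [SimpleGraph.mem_incidenceFinset]
    exact ⟨hab, by simp⟩
  calc (coveredEdges G T).card
      ≤ _ := Finset.card_le_card hsub
    _ ≤ _ := Finset.card_union_le _ _
    _ = _ := by
      rw [Finset.card_erase_of_mem hmem, G.card_incidenceFinset_eq_degree, hreg a]

end Coverage

lemma exists_isWinningCommittee {γ β : Type*} [LinearOrder β] {C : Finset γ} {k : ℕ}
    (hk : k ≤ C.card) (score : Finset γ → β) :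
    ∃ w, IsWinningCommittee C k score w := by
  obtain ⟨w, hw, hmax⟩ := Finset.exists_max_image (C.powersetCard k) score
    (Finset.powersetCard_nonempty.2 hk)
  obtain ⟨hwC, hwk⟩ := Finset.mem_powersetCard.1 hw
  exact ⟨w, hwC, hwk, fun w' h h' => hmax w' (Finset.mem_powersetCard.2 ⟨h, h'⟩)⟩

/-- in the CCAV election built from a `d`-regular graph (`d ≥ 1`), the
distinguished candidate `p` is in no winning `κ`-committee iff the graph has an
independent set of size `κ`. -/
theorem nwd_ccav_iff_indepSet {U : Type*} [Fintype U] [DecidableEq U]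
    (G : SimpleGraph U) [DecidableRel G.Adj] (d κ : ℕ)
    (hd : 1 ≤ d) (hreg : G.IsRegularOfDegree d)
    (hκ1 : 1 ≤ κ) (hκ2 : κ ≤ Fintype.card U) :
    (∀ w : Finset (U ⊕ Unit),
        IsWinningCommittee Finset.univ κ
          (ccavCom
            (G.edgeFinset.val.map
                (fun e => (Finset.univ.filter (· ∈ e)).image (Sum.inl : U → U ⊕ Unit))
              + Multiset.replicate (d - 1) {(Sum.inr () : U ⊕ Unit)})) w →
        (Sum.inr () : U ⊕ Unit) ∉ w)
    ↔ ∃ S : Finset U, S.card = κ ∧ ∀ a ∈ S, ∀ b ∈ S, ¬ G.Adj a b := by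
  have hscore := ccavCom_edgeVotes_add_replicate G (d - 1)
  constructor
  · intro h
    obtain ⟨w, hw⟩ := exists_isWinningCommittee (C := (Finset.univ : Finset (U ⊕ Unit)))
      (k := κ) (by rw [Finset.card_univ, Fintype.card_sum]; omega)
      (ccavCom
        (G.edgeFinset.val.map
            (fun e => (Finset.univ.filter (· ∈ e)).image (Sum.inl : U → U ⊕ Unit))
          + Multiset.replicate (d - 1) {(Sum.inr () : U ⊕ Unit)}))
    have hp := h w hw
    have hright : w.toRight = ∅ := by
      ext ⟨⟩
      simpa using hp
    have hcard : w.toLeft.card = κ := by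
      have := w.card_toLeft_add_card_toRight
      rw [hright, Finset.card_empty, hw.2.1] at this
      omega
    refine ⟨w.toLeft, hcard, fun a ha b hb hab => ?_⟩
    refine h ((w.toLeft.erase a).disjSum Finset.univ)
      ⟨Finset.subset_univ _, ?_, fun w' hC hk => (hw.2.2 w' hC hk).trans ?_⟩ (by simp)
    · rw [Finset.card_disjSum, Finset.card_erase_of_mem ha, hcard, Finset.card_univ,
        Fintype.card_unit]
      omega
    · rw [hscore, hscore, if_neg hp, if_pos (by simp), Finset.toLeft_disjSum]
      exact card_coveredEdges_le_erase hreg ha hb hab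
  · rintro ⟨S, hS, hind⟩ w hw hp
    have hle := hw.2.2 (S.disjSum ∅) (Finset.subset_univ _) (by simp [hS])
    rw [hscore, hscore, if_pos hp, if_neg (by simp), Finset.toLeft_disjSum,
      card_coveredEdges_of_indep hreg hind, hS] at hle
    have hcov := card_coveredEdges_le hreg w.toLeft
    have hpos : 0 < w.toRight.card := Finset.card_pos.2 ⟨(), Finset.mem_toRight.2 hp⟩
    have hcard := w.card_toLeft_add_card_toRight
    rw [hw.2.1] at hcard
    have hmul : (w.toLeft.card + 1) * d ≤ κ * d := Nat.mul_le_mul_right d (by omega)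
    rw [Nat.add_mul, Nat.one_mul] at hmul
    omega

end ApprovalBribery
end

section
/- Let G = (U,A) be a finite simple graph in which every vertex has degree exactly d for some integer d ≥ 1, and let κ be an integer with 1 ≤ κ ≤ |U|. Consider the approval election with candidate set C = U ∪ {p}, where p ∉ U, and whose votes are: for each edge {u,u'} ∈ A two votes each equal to {u,u'}, together with 2d−1 votes each equal to {p}. Then p belongs to no winning κ-committee under PAV if and only if G has an independent set of size κ. -/
namespace ApprovalBribery

variable {α : Type*} [DecidableEq α]

theorem pavCom_add (V V' : Multiset (Finset α)) (w : Finset α) :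
    pavCom (V + V') w = pavCom V w + pavCom V' w := by
  simp [pavCom]

theorem pavCom_replicate_singleton (n : ℕ) (c : α) (w : Finset α) :
    pavCom (Multiset.replicate n {c}) w = if c ∈ w then (n : ℚ) else 0 := by
  by_cases h : c ∈ w <;> simp [pavCom, h]

/-- The edges of `G` with both endpoints in `S`. -/
def edgesWithin {U : Type*} [Fintype U] [DecidableEq U] (G : SimpleGraph U)
    [DecidableRel G.Adj] (S : Finset U) : Finset (Sym2 U) :=
  G.edgeFinset.filter fun e => ∀ x ∈ e, x ∈ S

theorem two_mul_sum_inv_eq_of_not_isDiag {U : Type*} [Fintype U] [DecidableEq U]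
    (e : Sym2 U) (he : ¬ e.IsDiag) (w : Finset (U ⊕ Unit)) :
    2 * ∑ i ∈ Finset.range
        (((Finset.univ.filter (· ∈ e)).image (Sum.inl : U → U ⊕ Unit)) ∩ w).card,
          ((i : ℚ) + 1)⁻¹ =
      2 * ((w.toLeft.filter (· ∈ e)).card : ℚ) - if ∀ x ∈ e, x ∈ w.toLeft then 1 else 0 := by
  have hc : (((Finset.univ.filter (· ∈ e)).image (Sum.inl : U → U ⊕ Unit)) ∩ w) =
      (w.toLeft.filter (· ∈ e)).image Sum.inl := by
    ext x
    simp only [Finset.mem_inter, Finset.mem_image, Finset.mem_filter, Finset.mem_univ, true_and,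
      Finset.mem_toLeft]
    constructor
    · rintro ⟨⟨a, ha, rfl⟩, hx⟩
      exact ⟨a, ⟨hx, ha⟩, rfl⟩
    · rintro ⟨a, ⟨hx, ha⟩, rfl⟩
      exact ⟨⟨a, ha, rfl⟩, hx⟩
  rw [hc, Finset.card_image_of_injective _ Sum.inl_injective]
  generalize w.toLeft = S
  induction e with
  | _ a b =>
    have hab : a ≠ b := he
    have hf : S.filter (· ∈ s(a, b)) = ({a, b} : Finset U).filter (· ∈ S) := by
      ext x
      simp [and_comm]
    rw [hf]
    by_cases ha : a ∈ S <;> by_cases hb : b ∈ S <;>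
      simp [Finset.filter_insert, Finset.filter_singleton, ha, hb, hab, Finset.sum_range_succ]
    norm_num

theorem sum_card_filter_mem_edge {U : Type*} [Fintype U] [DecidableEq U]
    (G : SimpleGraph U) [DecidableRel G.Adj] (S : Finset U) :
    ∑ e ∈ G.edgeFinset, (S.filter (· ∈ e)).card = ∑ a ∈ S, G.degree a := by
  have h := Finset.sum_card_bipartiteAbove_eq_sum_card_bipartiteBelow
    (s := S) (t := G.edgeFinset) (fun a e => a ∈ e)
  simp only [Finset.bipartiteAbove, Finset.bipartiteBelow] at h
  rw [← h]
  refine Finset.sum_congr rfl fun a _ => ?_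
  rw [← G.card_incidenceFinset_eq_degree, G.incidenceFinset_eq_filter]

theorem pavCom_regularGraph {U : Type*} [Fintype U] [DecidableEq U]
    (G : SimpleGraph U) [DecidableRel G.Adj] {d : ℕ} (hreg : G.IsRegularOfDegree d)
    (n : ℕ) (w : Finset (U ⊕ Unit)) :
    pavCom
      (G.edgeFinset.val.map
          (fun e => (Finset.univ.filter (· ∈ e)).image (Sum.inl : U → U ⊕ Unit))
        + G.edgeFinset.val.map
          (fun e => (Finset.univ.filter (· ∈ e)).image (Sum.inl : U → U ⊕ Unit))
        + Multiset.replicate n {(Sum.inr () : U ⊕ Unit)}) w =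
      2 * d * (w.toLeft.card : ℚ) - (edgesWithin G w.toLeft).card +
        if (Sum.inr () : U ⊕ Unit) ∈ w then (n : ℚ) else 0 := by
  rw [pavCom_add, pavCom_add, pavCom_replicate_singleton, ← two_mul]
  congr 1
  have hsum : ∑ e ∈ G.edgeFinset, ((w.toLeft.filter (· ∈ e)).card : ℚ) =
      w.toLeft.card * d := by
    have h := sum_card_filter_mem_edge G w.toLeft
    simp only [hreg.degree_eq, Finset.sum_const, smul_eq_mul] at h
    exact_mod_cast h
  rw [pavCom, Multiset.map_map]
  change 2 * ∑ e ∈ G.edgeFinset, _ = _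
  simp only [Function.comp_apply]
  rw [Finset.mul_sum, Finset.sum_congr rfl fun e he => two_mul_sum_inv_eq_of_not_isDiag e
      (G.not_isDiag_of_mem_edgeFinset he) w, Finset.sum_sub_distrib, ← Finset.mul_sum, hsum,
    Finset.sum_boole, edgesWithin]
  ring

theorem edgesWithin_eq_empty {U : Type*} [Fintype U] [DecidableEq U]
    (G : SimpleGraph U) [DecidableRel G.Adj] {S : Finset U}
    (hS : ∀ a ∈ S, ∀ b ∈ S, ¬ G.Adj a b) : edgesWithin G S = ∅ := by
  refine Finset.filter_eq_empty_iff.2 fun e he h => ?_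
  induction e with
  | _ a b =>
    exact hS a (h a (by simp)) b (h b (by simp)) (by simpa using he)

theorem card_edgesWithin_erase_lt {U : Type*} [Fintype U] [DecidableEq U]
    (G : SimpleGraph U) [DecidableRel G.Adj] {S : Finset U} {a b : U}
    (ha : a ∈ S) (hb : b ∈ S) (hab : G.Adj a b) :
    (edgesWithin G (S.erase a)).card < (edgesWithin G S).card := by
  refine Finset.card_lt_card (Finset.ssubset_iff_of_subset ?_ |>.2 ⟨s(a, b), ?_, ?_⟩)
  · intro e he
    rw [edgesWithin, Finset.mem_filter] at he ⊢
    exact ⟨he.1, fun x hx => Finset.mem_of_mem_erase (he.2 x hx)⟩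
  · simp [edgesWithin, ha, hb, hab]
  · simp [edgesWithin]

theorem exists_isWinningCommittee_s2 {C : Type*} [Fintype C] (f : Finset C → ℚ) {k : ℕ}
    (hk : k ≤ Fintype.card C) : ∃ w, IsWinningCommittee Finset.univ k f w := by
  obtain ⟨w, hw, hmax⟩ := Finset.exists_max_image (Finset.univ.powersetCard k) f
    (Finset.powersetCard_nonempty.2 hk)
  rw [Finset.mem_powersetCard] at hw
  exact ⟨w, hw.1, hw.2, fun w' h h' => hmax w' (Finset.mem_powersetCard.2 ⟨h, h'⟩)⟩

/-- in the PAV election built from a `d`-regular graph (`d ≥ 1`), with two votes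
per edge and `2d − 1` votes `{p}`, the candidate `p` is in no winning `κ`-committee iff the
graph has an independent set of size `κ`. -/
theorem nwd_pav_iff_indepSet {U : Type*} [Fintype U] [DecidableEq U]
    (G : SimpleGraph U) [DecidableRel G.Adj] (d κ : ℕ)
    (hd : 1 ≤ d) (hreg : G.IsRegularOfDegree d)
    (hκ1 : 1 ≤ κ) (hκ2 : κ ≤ Fintype.card U) :
    (∀ w : Finset (U ⊕ Unit),
        IsWinningCommittee Finset.univ κ
          (pavCom
            (G.edgeFinset.val.map
                (fun e => (Finset.univ.filter (· ∈ e)).image (Sum.inl : U → U ⊕ Unit))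
              + G.edgeFinset.val.map
                (fun e => (Finset.univ.filter (· ∈ e)).image (Sum.inl : U → U ⊕ Unit))
              + Multiset.replicate (2 * d - 1) {(Sum.inr () : U ⊕ Unit)})) w →
        (Sum.inr () : U ⊕ Unit) ∉ w)
    ↔ ∃ S : Finset U, S.card = κ ∧ ∀ a ∈ S, ∀ b ∈ S, ¬ G.Adj a b := by
  have hscore := pavCom_regularGraph G hreg (2 * d - 1)
  revert hscore
  generalize pavCom (α := U ⊕ Unit) _ = f
  intro hf
  have hcast : ((2 * d - 1 : ℕ) : ℚ) = 2 * d - 1 := by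
    rw [Nat.cast_sub (by omega)]
    push_cast
    ring
  constructor
  · intro hp
    obtain ⟨w, hw⟩ := exists_isWinningCommittee_s2 f (k := κ)
      (by rw [Fintype.card_sum]; omega)
    have hpw := hp w hw
    obtain ⟨-, hcard, hmax⟩ := hw
    have hw_eq : w = w.toLeft.map Function.Embedding.inl := by
      ext x
      rcases x with x | ⟨⟩ <;> simp [hpw]
    have hSc : w.toLeft.card = κ := by
      rw [← hcard]
      conv_rhs => rw [hw_eq, Finset.card_map]
    refine ⟨w.toLeft, hSc, fun a ha b hb hab => ?_⟩
    have hlt := card_edgesWithin_erase_lt G ha hb hab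
    have hle : (((edgesWithin G (w.toLeft.erase a)).card : ℚ)) + 1 ≤
        (edgesWithin G w.toLeft).card := by
      exact_mod_cast hlt
    have hec : (w.toLeft.erase a).card + 1 = κ := by
      rw [Finset.card_erase_add_one ha, hSc]
    have hecq : ((w.toLeft.erase a).card : ℚ) = κ - 1 := by
      rw [← hec]
      push_cast
      ring
    set w' : Finset (U ⊕ Unit) := (w.toLeft.erase a).disjSum {()} with hw'
    have hw'c : w'.card = κ := by simpa [hw', Finset.card_disjSum] using hec
    have hpw' : (Sum.inr () : U ⊕ Unit) ∈ w' := by simp [hw']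
    have hge : f w ≤ f w' := by
      rw [hf w, hf w', if_neg hpw, if_pos hpw', hcast, hw', Finset.toLeft_disjSum, hecq, hSc]
      linarith
    exact hp w' ⟨Finset.subset_univ _, hw'c, fun v hv hvc => (hmax v hv hvc).trans hge⟩ hpw'
  · rintro ⟨S, hS, hind⟩ w ⟨-, hcard, hmax⟩ hpw
    have h := hmax (S.map Function.Embedding.inl) (Finset.subset_univ _)
      (by rw [Finset.card_map, hS])
    have hleft : (S.map (Function.Embedding.inl : U ↪ U ⊕ Unit)).toLeft = S := by
      ext x
      simp
    have hwc : w.toLeft.card + 1 = κ := by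
      have hr : w.toRight = {()} := by
        ext x
        simpa using hpw
      rw [← hcard, ← Finset.card_toLeft_add_card_toRight (u := w), hr, Finset.card_singleton]
    have hwcq : (w.toLeft.card : ℚ) = κ - 1 := by
      rw [← hwc]
      push_cast
      ring
    rw [hf, hf, if_pos hpw, if_neg (by simp), hcast, hleft, edgesWithin_eq_empty G hind, hS,
      hwcq, Finset.card_empty, Nat.cast_zero] at h
    have hnn : (0 : ℚ) ≤ (edgesWithin G w.toLeft).card := Nat.cast_nonneg _
    linarith

end ApprovalBribery
end

section
/- Let (X,𝒞) be an RX3C instance with |X| = 3κ, where κ > 4 is even. Consider the approval election with candidate set C = X ∪ {p}, p ∉ X, whose votes are: (3κ²/4 − 3κ) votes each equal to X, and for each H ∈ 𝒞 one vote equal to H. Then it is possible to perform at most κ approval additions (each single addition inserts one candidate into one vote not already containing it) so that in the resulting election no candidate of X belongs to any winning 1-committee under SAV, if and only if 𝒞 contains an exact cover of X. -/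
namespace ApprovalBribery

variable {α : Type*} [DecidableEq α]

theorem savCom_singleton (V : Multiset (Finset α)) (c : α) : savCom V {c} = savScore V c := by
  unfold savCom savScore
  congr 1
  refine Multiset.map_congr rfl fun v _ => ?_
  by_cases h : c ∈ v <;> simp [h]

theorem sum_savScore (C : Finset α) (V : Multiset (Finset α))
    (hV : ∀ v ∈ V, v ⊆ C ∧ v.Nonempty) : ∑ c ∈ C, savScore V c = V.card := by
  induction V using Multiset.induction_on with
  | empty => simp [savScore]
  | cons a V ih =>
    have hcons : ∀ c, savScore (a ::ₘ V) c = (if c ∈ a then (a.card : ℚ)⁻¹ else 0) + savScore V c :=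
      fun c => by simp [savScore]
    obtain ⟨hsub, hne⟩ := hV a (Multiset.mem_cons_self a V)
    have hcard : (a.card : ℚ) ≠ 0 := by exact_mod_cast hne.card_pos.ne'
    simp only [hcons, Finset.sum_add_distrib]
    rw [ih fun v hv => hV v (Multiset.mem_cons_of_mem hv), ← Finset.sum_filter,
      Finset.filter_mem_eq_inter, Finset.inter_eq_right.mpr hsub]
    simp [hcard, add_comm]

/-- No member of `X` belongs to a winning `1`-committee exactly when `p` strictly beats all
of them. -/
theorem forall_winning_notMem_iff (X : Finset α) (p : α) (hp : p ∉ X)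
    (V : Multiset (Finset α)) :
    (∀ w, IsWinningCommittee (insert p X) 1 (savCom V) w → ∀ x ∈ X, x ∉ w) ↔
      ∀ x ∈ X, savScore V x < savScore V p := by
  have hwin : ∀ c ∈ insert p X, (∀ d ∈ insert p X, savScore V d ≤ savScore V c) →
      IsWinningCommittee (insert p X) 1 (savCom V) {c} := by
    intro c hc hmax
    refine ⟨Finset.singleton_subset_iff.mpr hc, Finset.card_singleton c, fun w hw hw1 => ?_⟩
    obtain ⟨d, rfl⟩ := Finset.card_eq_one.mp hw1
    rw [savCom_singleton, savCom_singleton]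
    exact hmax d (Finset.singleton_subset_iff.mp hw)
  constructor
  · intro h x hx
    obtain ⟨c, hc, hmax⟩ := Finset.exists_max_image (insert p X) (savScore V) ⟨p, by simp⟩
    have hcX : c ∉ X := fun hcX => h _ (hwin c hc hmax) c hcX (by simp)
    obtain rfl : c = p := (Finset.mem_insert.mp hc).resolve_right hcX
    by_contra! hle
    exact h _ (hwin x (Finset.mem_insert_of_mem hx) fun d hd => (hmax d hd).trans hle) x hx
      (by simp)
  · rintro h w ⟨-, hw1, hmax⟩ x hx hxw
    obtain ⟨c, rfl⟩ := Finset.card_eq_one.mp hw1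
    obtain rfl := Finset.mem_singleton.mp hxw
    have := hmax {p} (by simp) (by simp)
    rw [savCom_singleton, savCom_singleton] at this
    exact absurd (h x hx) this.not_gt

theorem sum_inv_card_of_isRX3C {X : Finset α} {𝒞 : Finset (Finset α)} {κ : ℕ}
    (hR : IsRX3C X 𝒞 κ) {x : α} (hx : x ∈ X) :
    ∑ H ∈ 𝒞, (if x ∈ H then (H.card : ℚ)⁻¹ else 0) = 1 := by
  obtain ⟨-, -, h3, hdeg⟩ := hR
  rw [← Finset.sum_filter, Finset.sum_congr rfl (g := fun _ => (3 : ℚ)⁻¹)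
    fun H hH => by rw [(h3 H (Finset.mem_filter.mp hH).1).2]; norm_num]
  simp [hdeg x hx]

theorem savScore_replicate_add (X : Finset α) (S : Multiset (Finset α)) (m : ℕ) (x : α) :
    savScore (Multiset.replicate m X + S) x =
      m * (if x ∈ X then (X.card : ℚ)⁻¹ else 0) + savScore S x := by
  simp [savScore]

theorem cast_three_mul_sq_div_four_sub {κ : ℕ} (hκ : 4 < κ) (hκeven : Even κ) :
    ((3 * κ ^ 2 / 4 - 3 * κ : ℕ) : ℚ) = 3 * (κ : ℚ) ^ 2 / 4 - 3 * κ := by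
  obtain ⟨k, rfl⟩ := hκeven
  have h : 3 * (k + k) ^ 2 / 4 = 3 * k ^ 2 := by
    rw [show 3 * (k + k) ^ 2 = 4 * (3 * k ^ 2) by ring]; simp
  rw [h, Nat.cast_sub (by nlinarith)]
  push_cast
  ring

theorem savScore_of_isRX3C {X : Finset α} {𝒞 : Finset (Finset α)} {κ : ℕ}
    (hκ : 4 < κ) (hκeven : Even κ) (hR : IsRX3C X 𝒞 κ) {x : α} (hx : x ∈ X) :
    savScore (Multiset.replicate (3 * κ ^ 2 / 4 - 3 * κ) X + 𝒞.val) x = κ / 4 := by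
  have h𝒞 : savScore 𝒞.val x = 1 := sum_inv_card_of_isRX3C hR hx
  have hκ0 : (κ : ℚ) ≠ 0 := by
    have : κ ≠ 0 := by omega
    exact_mod_cast this
  rw [savScore_replicate_add, h𝒞, cast_three_mul_sq_div_four_sub hκ hκeven, if_pos hx, hR.1]
  push_cast
  field_simp
  ring

theorem sum_card_filter_mem_of_isRX3C {X : Finset α} {𝒞 𝒞' : Finset (Finset α)} {κ : ℕ}
    (hR : IsRX3C X 𝒞 κ) (hsub : 𝒞' ⊆ 𝒞) :
    ∑ x ∈ X, (𝒞'.filter fun H => x ∈ H).card = 3 * 𝒞'.card := by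
  have h := Finset.sum_card_bipartiteAbove_eq_sum_card_bipartiteBelow
    (s := X) (t := 𝒞') fun x H => x ∈ H
  simp only [Finset.bipartiteAbove, Finset.bipartiteBelow] at h
  rw [h, Finset.sum_congr rfl (g := fun _ => 3), Finset.sum_const, smul_eq_mul, mul_comm]
  intro H hH
  obtain ⟨hHX, hH3⟩ := hR.2.2.1 H (hsub hH)
  rw [Finset.filter_mem_eq_inter, Finset.inter_eq_right.mpr hHX, hH3]

theorem ite_inv_card_le {v v' : Finset α} {p : α} (hsub : v ⊆ v') (hpv : p ∉ v)
    (hv : 3 ≤ v.card) :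
    (if p ∈ v' then (v'.card : ℚ)⁻¹ else 0) ≤ ((v' \ v).card : ℚ) / 4 := by
  have hcard := Finset.card_sdiff_add_card_eq_card hsub
  split_ifs with h
  · have h1 : 1 ≤ (v' \ v).card := Finset.card_pos.mpr ⟨p, by simp [h, hpv]⟩
    have h4 : (4 : ℚ) ≤ v'.card := by
      have : 4 ≤ v'.card := by omega
      exact_mod_cast this
    have h1' : (1 : ℚ) ≤ (v' \ v).card := by exact_mod_cast h1
    have := inv_anti₀ (by norm_num) h4
    linarith
  · positivity

/-- Adding approvals other than a single approval of `p` to a three-element vote is wasteful. -/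
theorem ite_inv_card_le_sub {v v' : Finset α} {p : α} (hsub : v ⊆ v') (hpv : p ∉ v)
    (hv : v.card = 3 ∨ 5 ≤ v.card) (hne : v' ≠ v) (hbad : v' = insert p v → v.card ≠ 3) :
    (if p ∈ v' then (v'.card : ℚ)⁻¹ else 0) ≤ ((v' \ v).card : ℚ) / 4 - 1 / 12 := by
  have hcard := Finset.card_sdiff_add_card_eq_card hsub
  have h1 : 1 ≤ (v' \ v).card := by
    rw [Nat.one_le_iff_ne_zero, Ne, Finset.card_eq_zero, Finset.sdiff_eq_empty_iff_subset]
    exact fun h => hne (h.antisymm hsub)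
  have h1' : (1 : ℚ) ≤ (v' \ v).card := by exact_mod_cast h1
  split_ifs with h
  · rcases Nat.lt_or_ge 1 (v' \ v).card with h2 | h2
    · have h4 : (4 : ℚ) ≤ v'.card := by
        have : 4 ≤ v'.card := by omega
        exact_mod_cast this
      have h2' : (2 : ℚ) ≤ (v' \ v).card := by exact_mod_cast h2
      have := inv_anti₀ (by norm_num) h4
      linarith
    · have hins : insert p v = v' := by
        apply Finset.eq_of_subset_of_card_le (Finset.insert_subset h hsub)
        rw [Finset.card_insert_of_notMem hpv]
        omega
      have h3 := hbad hins.symm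
      have h6 : (6 : ℚ) ≤ v'.card := by
        have : 6 ≤ v'.card := by omega
        exact_mod_cast this
      have := inv_anti₀ (by norm_num) h6
      linarith
  · linarith

theorem lt_savScore_of_forall_lt {X : Finset α} {κ : ℕ} {p : α} {V : Multiset (Finset α)}
    (hκ : 0 < κ) (hX : X.card = 3 * κ) (hp : p ∉ X)
    (hV : ∀ v ∈ V, v ⊆ insert p X ∧ v.Nonempty) (hcard : (V.card : ℚ) = 3 * (κ : ℚ) ^ 2 / 4)
    (hlt : ∀ x ∈ X, savScore V x < savScore V p) : (κ : ℚ) / 4 - 1 / 12 < savScore V p := by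
  have hne : X.Nonempty := Finset.card_pos.mp (by omega)
  have hsum := sum_savScore _ V hV
  have hsum_lt := Finset.sum_lt_sum_of_nonempty hne hlt
  rw [Finset.sum_insert hp, hcard] at hsum
  rw [Finset.sum_const, nsmul_eq_mul, hX] at hsum_lt
  push_cast at hsum_lt
  have hκ' : (0 : ℚ) < κ := by exact_mod_cast hκ
  by_contra! h
  nlinarith

theorem savScore_map_snd (P : Multiset (Finset α × Finset α)) (c : α) :
    savScore (P.map Prod.snd) c =
      (P.map fun q => if c ∈ q.2 then (q.2.card : ℚ)⁻¹ else 0).sum := by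
  simp [savScore, Multiset.map_map]

theorem savScore_map_snd_le {P : Multiset (Finset α × Finset α)} {p : α}
    (hP : ∀ q ∈ P, q.1 ⊆ q.2 ∧ p ∉ q.1 ∧ 3 ≤ q.1.card) :
    savScore (P.map Prod.snd) p ≤ ((P.map fun q => (q.2 \ q.1).card).sum : ℕ) / 4 := by
  rw [savScore_map_snd, Nat.cast_multiset_sum, Multiset.map_map, ← Multiset.sum_map_div]
  refine Multiset.sum_map_le_sum_map _ _ fun q hq => ?_
  obtain ⟨h1, h2, h3⟩ := hP q hq
  exact ite_inv_card_le h1 h2 h3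

/-- If the score of `p` exceeds `κ / 4 - 1 / 12`, then the only changes made are additions of `p`
to three-element votes. -/
theorem eq_or_eq_insert_of_lt_savScore {P : Multiset (Finset α × Finset α)} {p : α} {κ : ℕ}
    (hP : ∀ q ∈ P, q.1 ⊆ q.2 ∧ p ∉ q.1 ∧ (q.1.card = 3 ∨ 5 ≤ q.1.card))
    (hcost : (P.map fun q => (q.2 \ q.1).card).sum ≤ κ)
    (hlt : (κ : ℚ) / 4 - 1 / 12 < savScore (P.map Prod.snd) p) :
    ∀ q ∈ P, q.2 = q.1 ∨ (q.2 = insert p q.1 ∧ q.1.card = 3) := by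
  intro q hq
  by_contra! hbad
  obtain ⟨Q, rfl⟩ := Multiset.exists_cons_of_mem hq
  obtain ⟨h1, h2, h3⟩ := hP q hq
  have hq_le := ite_inv_card_le_sub h1 h2 h3 hbad.1 hbad.2
  have hQ := savScore_map_snd_le (P := Q) (p := p) fun r hr => by
    obtain ⟨h1, h2, h3⟩ := hP r (Multiset.mem_cons_of_mem hr)
    exact ⟨h1, h2, by omega⟩
  have hcost' : (((q.2 \ q.1).card + (Q.map fun q => (q.2 \ q.1).card).sum : ℕ) : ℚ) ≤ κ := by
    exact_mod_cast (by simpa using hcost)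
  have hsplit : savScore ((q ::ₘ Q).map Prod.snd) p =
      (if p ∈ q.2 then (q.2.card : ℚ)⁻¹ else 0) + savScore (Q.map Prod.snd) p := by
    simp [savScore]
  rw [hsplit] at hlt
  rw [Nat.cast_add] at hcost'
  linarith

theorem hasExactCover_of_card_le {X : Finset α} {𝒞 𝒞' : Finset (Finset α)} {κ : ℕ}
    (hR : IsRX3C X 𝒞 κ) (hsub : 𝒞' ⊆ 𝒞) (hcard : 𝒞'.card ≤ κ)
    (hcov : ∀ x ∈ X, ∃ H ∈ 𝒞', x ∈ H) : HasExactCover X 𝒞 := by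
  refine ⟨𝒞', hsub, ?_⟩
  have hsum := sum_card_filter_mem_of_isRX3C hR hsub
  have hone : ∀ x ∈ X, 1 ≤ (𝒞'.filter fun H => x ∈ H).card := fun x hx => by
    obtain ⟨H, hH, hxH⟩ := hcov x hx
    exact Finset.card_pos.mpr ⟨H, by simp [hH, hxH]⟩
  have hX : ∑ _x ∈ X, 1 = 3 * κ := by simp [hR.1]
  have hle := Finset.sum_le_sum hone
  have heq := (Finset.sum_eq_sum_iff_of_le hone).mp (by omega)
  exact fun x hx => (heq x hx).symm

theorem hasExactCover_of_approvalAdds {X : Finset α} {𝒞 : Finset (Finset α)} {κ : ℕ}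
    (hκ : 4 < κ) (hκeven : Even κ) (hR : IsRX3C X 𝒞 κ) {p : α} (hp : p ∉ X)
    {V' : Multiset (Finset α)}
    (hV' : ApprovalAdds (insert p X)
      (Multiset.replicate (3 * κ ^ 2 / 4 - 3 * κ) X + 𝒞.val) V' κ)
    (hlt : ∀ x ∈ X, savScore V' x < savScore V' p) : HasExactCover X 𝒞 := by
  obtain ⟨P, hfst, rfl, hP, hcost⟩ := hV'
  have hmem : ∀ q ∈ P, q.1 = X ∨ q.1 ∈ 𝒞 := fun q hq => by
    have h : q.1 ∈ Multiset.replicate (3 * κ ^ 2 / 4 - 3 * κ) X + 𝒞.val :=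
      hfst ▸ Multiset.mem_map_of_mem Prod.fst hq
    rw [Multiset.mem_add] at h
    exact h.imp Multiset.eq_of_mem_replicate id
  have hPprop : ∀ q ∈ P, q.1 ⊆ q.2 ∧ p ∉ q.1 ∧ (q.1.card = 3 ∨ 5 ≤ q.1.card) := fun q hq => by
    refine ⟨(hP q hq).1, ?_⟩
    rcases hmem q hq with h | h
    · rw [h, hR.1]
      exact ⟨hp, by omega⟩
    · obtain ⟨hHX, hH3⟩ := hR.2.2.1 _ h
      exact ⟨fun h => hp (hHX h), Or.inl hH3⟩
  have hnonempty : ∀ v ∈ P.map Prod.snd, v ⊆ insert p X ∧ v.Nonempty := fun v hv => by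
    obtain ⟨q, hq, rfl⟩ := Multiset.mem_map.mp hv
    refine ⟨(hP q hq).2, Finset.Nonempty.mono (hP q hq).1 (Finset.card_pos.mp ?_)⟩
    have := (hPprop q hq).2.2
    omega
  have hcard : ((P.map Prod.snd).card : ℚ) = 3 * (κ : ℚ) ^ 2 / 4 := by
    have h : ((P.map Prod.fst).card : ℚ) = 3 * (κ : ℚ) ^ 2 / 4 := by
      rw [← hfst, Multiset.card_add, Multiset.card_replicate, Finset.card_val, hR.2.1,
        Nat.cast_add, cast_three_mul_sq_div_four_sub hκ hκeven]
      push_cast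
      ring
    simpa using h
  have hscore := lt_savScore_of_forall_lt (by omega) hR.1 hp hnonempty hcard hlt
  have hgood := eq_or_eq_insert_of_lt_savScore hPprop hcost hscore
  let f : Finset α → Finset α × Finset α := fun H => (H, insert p H)
  have hfinj : Function.Injective f := fun _ _ h => (Prod.mk.inj h).1
  refine hasExactCover_of_card_le hR (Finset.filter_subset (fun H => f H ∈ P) 𝒞) ?_ ?_
  · have hle : (𝒞.filter fun H => f H ∈ P).val.map f ≤ P := by
      rw [Multiset.le_iff_subset (Multiset.Nodup.map hfinj (Finset.nodup _))]
      intro q hq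
      obtain ⟨H, hH, rfl⟩ := Multiset.mem_map.mp hq
      exact (Finset.mem_filter.mp hH).2
    obtain ⟨Q, hQ⟩ := Multiset.le_iff_exists_add.mp hle
    rw [hQ, Multiset.map_add, Multiset.sum_add, Multiset.map_map] at hcost
    refine le_trans ?_ ((Nat.le_add_right _ _).trans hcost)
    refine (Finset.card_eq_sum_ones _).trans_le (Finset.sum_le_sum fun H hH => ?_)
    have hpH : p ∉ H := fun h => hp ((hR.2.2.1 H (Finset.mem_filter.mp hH).1).1 h)
    exact Finset.card_pos.mpr ⟨p, by simp [f, hpH]⟩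
  · intro x hx
    by_contra! hx'
    have hxscore : savScore (P.map Prod.snd) x = κ / 4 := by
      rw [← savScore_of_isRX3C hκ hκeven hR hx, hfst]
      simp only [savScore, Multiset.map_map]
      congr 1
      refine Multiset.map_congr rfl fun q hq => ?_
      rcases hgood q hq with h | ⟨h, h3⟩
      · simp [h]
      · have hq𝒞 : q.1 ∈ 𝒞 := (hmem q hq).resolve_left fun h => by
          have := hR.1
          rw [h] at h3
          omega
        have hxq : x ∉ q.1 := hx' q.1 (Finset.mem_filter.mpr ⟨hq𝒞, by
          have : f q.1 = q := Prod.ext rfl h.symm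
          rwa [this]⟩)
        have hxp : x ≠ p := fun h => hp (h ▸ hx)
        simp [h, hxq, hxp]
    have hp_le := savScore_map_snd_le (P := P) (p := p) fun q hq => by
      obtain ⟨h1, h2, h3⟩ := hPprop q hq
      exact ⟨h1, h2, by omega⟩
    have hcost' : (((P.map fun q => (q.2 \ q.1).card).sum : ℕ) : ℚ) ≤ κ := by exact_mod_cast hcost
    have := hlt x hx
    linarith

theorem exists_approvalAdds_of_hasExactCover {X : Finset α} {𝒞 : Finset (Finset α)} {κ : ℕ}
    (hκ : 4 < κ) (hκeven : Even κ) (hR : IsRX3C X 𝒞 κ) {p : α} (hp : p ∉ X)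
    (hcover : HasExactCover X 𝒞) :
    ∃ V', ApprovalAdds (insert p X)
        (Multiset.replicate (3 * κ ^ 2 / 4 - 3 * κ) X + 𝒞.val) V' κ ∧
      ∀ x ∈ X, savScore V' x < savScore V' p := by
  obtain ⟨𝒞', hsub, hone⟩ := hcover
  have hcard' : 𝒞'.card = κ := by
    have h := sum_card_filter_mem_of_isRX3C hR hsub
    rw [Finset.sum_congr rfl hone] at h
    have := hR.1
    simp at h
    omega
  have hpH : ∀ H ∈ 𝒞, p ∉ H := fun H hH h => hp ((hR.2.2.1 H hH).1 h)
  let f : Finset α → Finset α := fun H => if H ∈ 𝒞' then insert p H else H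
  have hfH : ∀ H ∈ 𝒞, (f H \ H).card = if H ∈ 𝒞' then 1 else 0 := fun H hH => by
    by_cases h : H ∈ 𝒞' <;> simp [f, h, hpH H hH]
  refine ⟨Multiset.replicate (3 * κ ^ 2 / 4 - 3 * κ) X + 𝒞.val.map f,
    ⟨Multiset.replicate (3 * κ ^ 2 / 4 - 3 * κ) (X, X) + 𝒞.val.map fun H => (H, f H),
      by simp, by simp, ?_, ?_⟩, ?_⟩
  · intro q hq
    rcases Multiset.mem_add.mp hq with h | h
    · rw [Multiset.eq_of_mem_replicate h]
      exact ⟨subset_rfl, Finset.subset_insert p X⟩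
    · obtain ⟨H, hH, rfl⟩ := Multiset.mem_map.mp h
      have hHX := (hR.2.2.1 H hH).1
      by_cases hH' : H ∈ 𝒞'
      · simpa [f, hH'] using Finset.insert_subset_insert p hHX
      · simpa [f, hH'] using hHX.trans (Finset.subset_insert p X)
  · have h : ∑ H ∈ 𝒞, (f H \ H).card = κ := by
      rw [Finset.sum_congr rfl hfH, ← Finset.sum_filter, Finset.filter_mem_eq_inter,
        Finset.inter_eq_right.mpr hsub]
      simpa using hcard'
    simpa [Multiset.map_map, Function.comp_def] using h.le
  · intro x hx
    have hxp : x ≠ p := fun h => hp (h ▸ hx)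
    have hsum : ∀ c, savScore (𝒞.val.map f) c =
        ∑ H ∈ 𝒞, if c ∈ f H then ((f H).card : ℚ)⁻¹ else 0 := fun c => by
      simp [savScore, Multiset.map_map]
    have hpscore : savScore (𝒞.val.map f) p = κ / 4 := by
      rw [hsum, Finset.sum_congr rfl (g := fun H => if H ∈ 𝒞' then (4 : ℚ)⁻¹ else 0),
        ← Finset.sum_filter, Finset.filter_mem_eq_inter, Finset.inter_eq_right.mpr hsub]
      · simp [hcard', div_eq_mul_inv]
      · intro H hH
        by_cases h : H ∈ 𝒞'
        · simp only [f, h, if_true, Finset.mem_insert_self,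
            Finset.card_insert_of_notMem (hpH H hH), (hR.2.2.1 H hH).2]
          norm_num
        · simp [f, h, hpH H hH]
    have hxscore : savScore (𝒞.val.map f) x < savScore 𝒞.val x := by
      rw [hsum]
      change _ < ∑ H ∈ 𝒞, if x ∈ H then (H.card : ℚ)⁻¹ else 0
      have hins : ∀ H ∈ 𝒞, ((insert p H).card : ℚ) = 4 ∧ (H.card : ℚ) = 3 := fun H hH => by
        rw [Finset.card_insert_of_notMem (hpH H hH), (hR.2.2.1 H hH).2]
        norm_num
      refine Finset.sum_lt_sum (fun H hH => ?_) ?_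
      · obtain ⟨h4, h3⟩ := hins H hH
        by_cases h : H ∈ 𝒞' <;> by_cases hxH : x ∈ H <;> simp [f, h, hxH, hxp, h4, h3]
        norm_num
      · obtain ⟨H, hH⟩ := Finset.card_pos.mp (by rw [hone x hx]; exact one_pos)
        obtain ⟨hH', hxH⟩ := Finset.mem_filter.mp hH
        obtain ⟨h4, h3⟩ := hins H (hsub hH')
        refine ⟨H, hsub hH', ?_⟩
        simp [f, hH', hxH, h4, h3]
        norm_num
    have hxorig := savScore_of_isRX3C hκ hκeven hR hx
    rw [savScore_replicate_add] at hxorig ⊢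
    rw [savScore_replicate_add, if_neg hp, mul_zero, zero_add, hpscore]
    linarith

/-- destructive bribery by at most `κ` approval additions under SAV in the
election built from an RX3C instance succeeds iff the instance has an exact cover. -/
theorem appAdd_sav_rx3c
    (X : Finset α) (𝒞 : Finset (Finset α)) (κ : ℕ)
    (hκ : 4 < κ) (hκeven : Even κ) (hR : IsRX3C X 𝒞 κ)
    (p : α) (hp : p ∉ X) :
    (∃ V' : Multiset (Finset α),
        ApprovalAdds (insert p X)
          (Multiset.replicate (3 * κ ^ 2 / 4 - 3 * κ) X + 𝒞.val) V' κ ∧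
        ∀ w, IsWinningCommittee (insert p X) 1 (savCom V') w → ∀ x ∈ X, x ∉ w)
    ↔ HasExactCover X 𝒞 := by
  simp only [forall_winning_notMem_iff X p hp]
  exact ⟨fun ⟨_, hadds, hlt⟩ => hasExactCover_of_approvalAdds hκ hκeven hR hp hadds hlt,
    exists_approvalAdds_of_hasExactCover hκ hκeven hR hp⟩

end ApprovalBribery
end

section
/- Let (X,𝒞) be an RX3C instance with |X| = 3κ, where κ is a positive even integer. Consider the approval election with candidate set C = X ∪ {p}, p ∉ X, whose votes are: (9κ²/2 − 2κ) votes each equal to X, and for each H ∈ 𝒞 one vote equal to {p} ∪ H. Then it is possible to perform at most 3κ approval deletions (each single deletion removes one candidate from one vote containing it) so that in the resulting election no candidate of X belongs to any winning 1-committee under SAV, if and only if 𝒞 contains an exact cover of X. -/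
namespace ApprovalBribery

variable {α : Type*} [DecidableEq α]

/-- The points that a vote `v` gives to the candidate `c` under SAV. -/
def share (v : Finset α) (c : α) : ℚ := ((v ∩ {c}).card : ℚ) / (v.card : ℚ)

lemma share_of_mem {v : Finset α} {c : α} (h : c ∈ v) : share v c = (v.card : ℚ)⁻¹ := by
  simp [share, Finset.inter_singleton_of_mem h]

lemma share_of_notMem {v : Finset α} {c : α} (h : c ∉ v) : share v c = 0 := by
  simp [share, Finset.inter_singleton_of_notMem h]

lemma share_nonneg (v : Finset α) (c : α) : 0 ≤ share v c := by
  unfold share; positivity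

lemma sum_share {v S : Finset α} (h : v ⊆ S) :
    ∑ c ∈ S, share v c = 1 - if v = ∅ then 1 else 0 := by
  rw [← Finset.sum_subset h fun c _ hc => share_of_notMem hc,
    Finset.sum_congr rfl fun c hc => share_of_mem hc, Finset.sum_const, nsmul_eq_mul]
  split_ifs with h0
  · simp [h0]
  · have : (v.card : ℚ) ≠ 0 := by simpa using h0
    rw [mul_inv_cancel₀ this, sub_zero]

/-- No element of `X` is a winning singleton iff the outside candidate beats all of `X`. -/
lemma forall_notMem_winning_iff {X : Finset α} {p : α}
    (score : Finset α → ℚ) :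
    (∀ w, IsWinningCommittee (insert p X) 1 score w → ∀ x ∈ X, x ∉ w) ↔
      ∀ x ∈ X, score {x} < score {p} := by
  have winning {c : α} (hc : c ∈ insert p X)
      (hmax : ∀ d ∈ insert p X, score {d} ≤ score {c}) :
      IsWinningCommittee (insert p X) 1 score {c} := by
    refine ⟨by simpa using hc, by simp, fun w hw hw1 => ?_⟩
    obtain ⟨d, rfl⟩ := Finset.card_eq_one.1 hw1
    exact hmax d (by simpa using hw)
  constructor
  · intro h x hx
    by_contra! hlt
    obtain ⟨c, hc, hmax⟩ := Finset.exists_max_image (insert p X) (fun c => score {c})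
      ⟨p, Finset.mem_insert_self p X⟩
    rcases Finset.mem_insert.1 hc with rfl | hcX
    · exact h {x} (winning (Finset.mem_insert_of_mem hx) fun d hd => (hmax d hd).trans hlt)
        x hx (Finset.mem_singleton_self x)
    · exact h {c} (winning hc hmax) c hcX (Finset.mem_singleton_self c)
  · rintro h w ⟨-, hw1, hmax⟩ x hx hxw
    obtain ⟨d, rfl⟩ := Finset.card_eq_one.1 hw1
    obtain rfl := Finset.mem_singleton.1 hxw
    exact (h x hx).not_ge (hmax {p} (by simp) (by simp))

lemma exists_map_eq_of_map_eq {ι β γ : Type*} [Nonempty γ] (S : Finset ι) (f : γ → β)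
    (h : ι → β) (B : Multiset γ) (hB : B.map f = S.val.map h) :
    ∃ g : ι → γ, B = S.val.map g ∧ ∀ i ∈ S, f (g i) = h i := by
  classical
  induction S using Finset.induction_on generalizing B with
  | empty => exact ⟨fun _ => Classical.arbitrary γ, by simpa using hB, by simp⟩
  | insert a S ha ih =>
    rw [Finset.insert_val_of_notMem ha, Multiset.map_cons, ← Multiset.map_eq_cons] at hB
    obtain ⟨c, hc, hca, hB⟩ := hB
    obtain ⟨g, hg, hgh⟩ := ih _ hB
    have hne {i : ι} (hi : i ∈ S) : i ≠ a := fun hia => ha (hia ▸ hi)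
    refine ⟨Function.update g a c, ?_, ?_⟩
    · rw [Finset.insert_val_of_notMem ha, Multiset.map_cons, Function.update_self,
        ← Multiset.cons_erase hc, hg]
      congr 1
      exact Multiset.map_congr rfl fun i hi => (Function.update_of_ne (hne hi) _ _).symm
    · intro i hi
      rcases Finset.mem_insert.1 hi with rfl | hi
      · simpa using hca
      · rw [Function.update_of_ne (hne hi), hgh i hi]

lemma approvalDels_replicate_add_map_iff (X : Finset α) (𝒞 : Finset (Finset α))
    (f : Finset α → Finset α) (m l : ℕ) (V' : Multiset (Finset α)) :
    ApprovalDels (Multiset.replicate m X + 𝒞.val.map f) V' l ↔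
      ∃ (a : ℕ → Finset α) (b : Finset α → Finset α),
        V' = (Finset.range m).val.map a + 𝒞.val.map b ∧
        (∀ i ∈ Finset.range m, a i ⊆ X) ∧ (∀ H ∈ 𝒞, b H ⊆ f H) ∧
        ∑ i ∈ Finset.range m, (X \ a i).card + ∑ H ∈ 𝒞, (f H \ b H).card ≤ l := by
  constructor
  · rintro ⟨P, hV, rfl, hsub, hcost⟩
    have hmap : P.map Prod.fst = ((Finset.range m).disjSum 𝒞).val.map
        (Sum.elim (fun _ => X) f) := by
      rw [← hV, Finset.val_disjSum, Multiset.disjSum]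
      simp
    obtain ⟨g, rfl, hg⟩ := exists_map_eq_of_map_eq _ _ _ _ hmap
    have hga (i) (hi : i ∈ Finset.range m) : (g (Sum.inl i)).1 = X :=
      hg _ (Finset.inl_mem_disjSum.2 hi)
    have hgb (H) (hH : H ∈ 𝒞) : (g (Sum.inr H)).1 = f H :=
      hg _ (Finset.inr_mem_disjSum.2 hH)
    refine ⟨fun i => (g (Sum.inl i)).2, fun H => (g (Sum.inr H)).2, ?_, ?_, ?_, ?_⟩
    · rw [Finset.val_disjSum, Multiset.disjSum]
      simp
    · intro i hi
      rw [← hga i hi]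
      exact hsub _ (Multiset.mem_map_of_mem _ (Finset.inl_mem_disjSum.2 hi))
    · intro H hH
      rw [← hgb H hH]
      exact hsub _ (Multiset.mem_map_of_mem _ (Finset.inr_mem_disjSum.2 hH))
    · rw [Multiset.map_map] at hcost
      change ∑ i ∈ (Finset.range m).disjSum 𝒞, ((g i).1 \ (g i).2).card ≤ l at hcost
      rw [Finset.sum_disjSum] at hcost
      rw [Finset.sum_congr rfl fun i hi => by rw [← hga i hi],
        Finset.sum_congr (s₁ := 𝒞) rfl fun H hH => by rw [← hgb H hH]]
      exact hcost
  · rintro ⟨a, b, rfl, ha, hb, hcost⟩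
    refine ⟨(Finset.range m).val.map (fun i => (X, a i)) + 𝒞.val.map (fun H => (f H, b H)),
      by simp, by simp, ?_, ?_⟩
    · intro q hq
      rcases Multiset.mem_add.1 hq with hq | hq
      · obtain ⟨i, hi, rfl⟩ := Multiset.mem_map.1 hq
        exact ha i hi
      · obtain ⟨H, hH, rfl⟩ := Multiset.mem_map.1 hq
        exact hb H hH
    · rw [Multiset.map_add, Multiset.sum_add, Multiset.map_map, Multiset.map_map]
      exact hcost

lemma savCom_singleton_s5 (m : ℕ) (𝒞 : Finset (Finset α)) (a : ℕ → Finset α)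
    (b : Finset α → Finset α) (c : α) :
    savCom ((Finset.range m).val.map a + 𝒞.val.map b) {c} =
      ∑ i ∈ Finset.range m, share (a i) c + ∑ H ∈ 𝒞, share (b H) c := by
  rw [savCom, Multiset.map_add, Multiset.sum_add, Multiset.map_map, Multiset.map_map]
  rfl

/-- In a vote of size four, deletions help `p` by at most `1/4` each, and this rate is attained
only by leaving the vote alone or by deleting everybody else. -/
lemma share_le_of_subset {v u : Finset α} {p : α} (hu : u.card = 4) (hvu : v ⊆ u) :
    share v p ≤ 1 / 4 + ((u \ v).card : ℚ) / 4 - (if v = ∅ then 1 else 0) / 4 -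
      (if v = u ∨ v = {p} then 0 else 1) / 6 := by
  have hcard := Finset.card_sdiff_add_card_eq_card hvu
  rw [hu] at hcard
  by_cases hvu' : v = u
  · subst hvu'
    have hne : v ≠ ∅ := by rintro rfl; simp at hu
    by_cases hpv : p ∈ v
    · simp [share_of_mem hpv, hu, hne]
    · simp [share_of_notMem hpv, hne]
  have hlt : v.card < 4 := hu ▸ Finset.card_lt_card (hvu.ssubset_of_ne hvu')
  by_cases hpv : p ∈ v
  · have hne : v ≠ ∅ := Finset.ne_empty_of_mem hpv
    have hpos : 0 < v.card := Finset.card_pos.2 ⟨p, hpv⟩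
    rw [share_of_mem hpv, if_neg hne]
    by_cases hv1 : v = {p}
    · subst hv1
      have : (u \ {p}).card = 3 := by simpa using hcard
      rw [this]
      norm_num
    · have h1 : v.card ≠ 1 := by
        intro h1
        obtain ⟨d, rfl⟩ := Finset.card_eq_one.1 h1
        exact hv1 (by rw [Finset.mem_singleton.1 hpv])
      rw [if_neg (by simp [hvu', hv1])]
      have h23 : (v.card = 2 ∧ (u \ v).card = 2) ∨ (v.card = 3 ∧ (u \ v).card = 1) := by omega
      rcases h23 with ⟨h, h'⟩ | ⟨h, h'⟩ <;> rw [h, h'] <;> norm_num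
  · rw [share_of_notMem hpv]
    have h1 : (1 : ℚ) ≤ ((u \ v).card : ℚ) := by
      have : 1 ≤ (u \ v).card := by omega
      exact_mod_cast this
    split_ifs <;> linarith

lemma share_le_of_subset_of_notMem {v X : Finset α} {p : α} (hp : p ∉ X) (hX : 2 ≤ X.card)
    (hv : v ⊆ X) :
    share v p ≤ ((X \ v).card : ℚ) / 4 - (if v = ∅ then 1 else 0) / 4 -
      (if v = X then 0 else 1) / 6 := by
  rw [share_of_notMem fun h => hp (hv h)]
  by_cases hvX : v = X
  · have hne : X ≠ ∅ := by rintro rfl; simp at hX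
    simp [hvX, hne]
  · have hcard : 1 ≤ (X \ v).card :=
      Finset.card_pos.2 (Finset.sdiff_nonempty.2 fun h => hvX (hv.antisymm h))
    rw [if_neg hvX]
    split_ifs with h0
    · have : (2 : ℚ) ≤ ((X \ v).card : ℚ) := by
        rw [h0, Finset.sdiff_empty]
        exact_mod_cast hX
      linarith
    · have : (1 : ℚ) ≤ ((X \ v).card : ℚ) := by exact_mod_cast hcard
      linarith

lemma sum_card_filter_mem {X : Finset α} {𝒞 : Finset (Finset α)}
    (h : ∀ H ∈ 𝒞, H ⊆ X ∧ H.card = 3) :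
    ∑ x ∈ X, (𝒞.filter fun H => x ∈ H).card = 3 * 𝒞.card := by
  simp_rw [Finset.card_filter]
  rw [Finset.sum_comm]
  simp_rw [← Finset.card_filter]
  rw [Finset.sum_congr rfl fun H hH => by
    rw [Finset.filter_mem_eq_inter, Finset.inter_eq_right.2 (h H hH).1, (h H hH).2]]
  simp [mul_comm]

lemma cast_number_of_full_votes {κ : ℕ} (hκ : 0 < κ) (hκeven : Even κ) :
    ((9 * κ ^ 2 / 2 - 2 * κ : ℕ) : ℚ) = 9 * (κ : ℚ) ^ 2 / 2 - 2 * κ := by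
  obtain ⟨j, rfl⟩ := hκeven
  have hdiv : 9 * (j + j) ^ 2 / 2 = 18 * j ^ 2 := by
    rw [show 9 * (j + j) ^ 2 = 18 * j ^ 2 * 2 by ring, Nat.mul_div_cancel _ two_pos]
  rw [hdiv, Nat.cast_sub (by nlinarith)]
  push_cast
  ring


lemma hasExactCover_of_covering {X : Finset α} {𝒞 𝒞' : Finset (Finset α)} (hsub : 𝒞' ⊆ 𝒞)
    (h3 : ∀ H ∈ 𝒞, H ⊆ X ∧ H.card = 3) (hcard : 3 * 𝒞'.card ≤ X.card)
    (hcov : ∀ x ∈ X, ∃ H ∈ 𝒞', x ∈ H) : HasExactCover X 𝒞 := by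
  refine ⟨𝒞', hsub, ?_⟩
  have hle : ∀ x ∈ X, 1 ≤ (𝒞'.filter fun H => x ∈ H).card := by
    intro x hx
    obtain ⟨H, hH, hxH⟩ := hcov x hx
    exact Finset.card_pos.2 ⟨H, Finset.mem_filter.2 ⟨hH, hxH⟩⟩
  have hsum := sum_card_filter_mem fun H hH => h3 H (hsub hH)
  have heq : ∑ _x ∈ X, 1 = ∑ x ∈ X, (𝒞'.filter fun H => x ∈ H).card :=
    le_antisymm (Finset.sum_le_sum hle) (by rw [hsum]; simpa using hcard)
  exact fun x hx => ((Finset.sum_eq_sum_iff_of_le hle).1 heq x hx).symm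

/-- Deleting exactly the sets of an exact cover from their votes makes `p` the sole winner. -/
lemma exists_dels_of_hasExactCover {X : Finset α} {𝒞 : Finset (Finset α)} {κ : ℕ}
    (hκ : 0 < κ) (hκeven : Even κ) (hR : IsRX3C X 𝒞 κ) {p : α} (hp : p ∉ X)
    (hcov : HasExactCover X 𝒞) :
    ∃ V' : Multiset (Finset α),
      ApprovalDels
        (Multiset.replicate (9 * κ ^ 2 / 2 - 2 * κ) X + 𝒞.val.map (insert p)) V' (3 * κ) ∧
      ∀ x ∈ X, savCom V' {x} < savCom V' {p} := by
  obtain ⟨hX, hC, h3, hdeg⟩ := hR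
  obtain ⟨𝒟, hsub, hone⟩ := hcov
  have hκ0 : (κ : ℚ) ≠ 0 := by positivity
  have hm := cast_number_of_full_votes hκ hκeven
  set m := 9 * κ ^ 2 / 2 - 2 * κ
  have hpH {H} (hH : H ∈ 𝒞) : p ∉ H := fun h => hp ((h3 H hH).1 h)
  have hcard4 {H} (hH : H ∈ 𝒞) : (insert p H).card = 4 := by
    rw [Finset.card_insert_of_notMem (hpH hH), (h3 H hH).2]
  have hD : 𝒟.card = κ := by
    have h := sum_card_filter_mem fun H hH => h3 H (hsub hH)
    rw [Finset.sum_congr rfl hone] at h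
    simp only [Finset.sum_const, smul_eq_mul, hX] at h
    omega
  have hfilter : 𝒞.filter (· ∈ 𝒟) = 𝒟 := by
    rw [Finset.filter_mem_eq_inter, Finset.inter_eq_right.2 hsub]
  set b : Finset α → Finset α := fun H => if H ∈ 𝒟 then {p} else insert p H with hb
  refine ⟨(Finset.range m).val.map (fun _ => X) + 𝒞.val.map b,
    (approvalDels_replicate_add_map_iff _ _ _ _ _ _).2
      ⟨fun _ => X, b, rfl, fun _ _ => subset_rfl, ?_, ?_⟩, ?_⟩
  · intro H _
    by_cases h : H ∈ 𝒟 <;> simp [hb, h]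
  · have hcost : ∀ H ∈ 𝒞, (insert p H \ b H).card = if H ∈ 𝒟 then 3 else 0 := by
      intro H hH
      by_cases h : H ∈ 𝒟
      · have : (insert p H \ {p}) = H := by
          rw [Finset.insert_sdiff_of_mem _ (Finset.mem_singleton_self p),
            Finset.sdiff_singleton_eq_erase, Finset.erase_eq_of_notMem (hpH hH)]
        simp [hb, h, this, (h3 H hH).2]
      · simp [hb, h]
    rw [Finset.sum_congr rfl hcost, ← Finset.sum_filter, hfilter]
    simp [hD, mul_comm]
  · intro x hx
    have hxp : x ≠ p := fun h => hp (h ▸ hx)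
    rw [savCom_singleton_s5, savCom_singleton_s5]
    have hscore : ∀ H ∈ 𝒞, share (b H) p = 1 / 4 + if H ∈ 𝒟 then 3 / 4 else 0 := by
      intro H hH
      by_cases h : H ∈ 𝒟
      · simp only [hb, h, if_true, share_of_mem (Finset.mem_singleton_self p)]
        norm_num
      · simp only [hb, h, if_false, share_of_mem (Finset.mem_insert_self p H), hcard4 hH]
        norm_num
    have hxscore : ∀ H ∈ 𝒞, share (b H) x =
        (if x ∈ H then 1 / 4 else 0) - if H ∈ 𝒟 then (if x ∈ H then 1 / 4 else 0) else 0 := by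
      intro H hH
      by_cases h : H ∈ 𝒟
      · simp [hb, h, share_of_notMem, hxp]
      · by_cases hxH : x ∈ H
        · simp [hb, h, hxH, share_of_mem, hcard4 hH]
        · simp [hb, h, hxH, share_of_notMem, hxp]
    rw [Finset.sum_congr rfl hscore, Finset.sum_congr (s₁ := 𝒞) rfl hxscore,
      Finset.sum_add_distrib, Finset.sum_sub_distrib]
    simp only [← Finset.sum_filter, hfilter]
    simp only [Finset.sum_const, share_of_mem hx, share_of_notMem hp, hX, hC, hD, hdeg x hx,
      hone x hx, Finset.card_range, nsmul_eq_mul, hm]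
    push_cast
    field_simp
    linarith

/-- If `p` beats every element of `X` after `3κ` deletions, the fully deleted sets form a cover. -/
lemma hasExactCover_of_forall_lt {X : Finset α} {𝒞 : Finset (Finset α)} {κ : ℕ}
    (hκ : 0 < κ) (hκeven : Even κ) (hR : IsRX3C X 𝒞 κ) {p : α} (hp : p ∉ X)
    {V' : Multiset (Finset α)}
    (hdel : ApprovalDels
      (Multiset.replicate (9 * κ ^ 2 / 2 - 2 * κ) X + 𝒞.val.map (insert p)) V' (3 * κ))
    (hlt : ∀ x ∈ X, savCom V' {x} < savCom V' {p}) : HasExactCover X 𝒞 := by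
  obtain ⟨hX, hC, h3, hdeg⟩ := hR
  have hκ1 : (1 : ℚ) ≤ κ := by exact_mod_cast hκ
  have hm := cast_number_of_full_votes hκ hκeven
  set m := 9 * κ ^ 2 / 2 - 2 * κ
  have hpH {H} (hH : H ∈ 𝒞) : p ∉ H := fun h => hp ((h3 H hH).1 h)
  have hcard4 {H} (hH : H ∈ 𝒞) : (insert p H).card = 4 := by
    rw [Finset.card_insert_of_notMem (hpH hH), (h3 H hH).2]
  have hXne : X.Nonempty := Finset.card_pos.1 (by omega)
  obtain ⟨a, b, rfl, ha, hb, hcost⟩ :=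
    (approvalDels_replicate_add_map_iff _ _ _ _ _ _).1 hdel
  simp only [savCom_singleton_s5] at hlt
  set score : α → ℚ := fun c =>
    ∑ i ∈ Finset.range m, share (a i) c + ∑ H ∈ 𝒞, share (b H) c with hscore
  change ∀ x ∈ X, score x < score p at hlt
  have htotal : ∑ c ∈ insert p X, score c =
      (m - ∑ i ∈ Finset.range m, if a i = ∅ then (1 : ℚ) else 0) +
      (3 * κ - ∑ H ∈ 𝒞, if b H = ∅ then (1 : ℚ) else 0) := by
    rw [hscore, Finset.sum_add_distrib, Finset.sum_comm, Finset.sum_comm (s := insert p X),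
      Finset.sum_congr rfl fun i hi =>
        sum_share ((ha i hi).trans (Finset.subset_insert p X)),
      Finset.sum_congr (s₁ := 𝒞) rfl fun H hH =>
        sum_share ((hb H hH).trans (Finset.insert_subset_insert p (h3 H hH).1)),
      Finset.sum_sub_distrib, Finset.sum_sub_distrib]
    simp [hC]
  have htotal_lt : ∑ c ∈ insert p X, score c < (3 * κ + 1) * score p := by
    rw [Finset.sum_insert hp]
    have := Finset.sum_lt_sum_of_nonempty hXne hlt
    rw [Finset.sum_const, hX, nsmul_eq_mul] at this
    push_cast at this
    linarith
  have hA := Finset.sum_le_sum fun i hi => share_le_of_subset_of_notMem hp (by omega) (ha i hi)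
  have hB := Finset.sum_le_sum fun H hH => share_le_of_subset (p := p) (hcard4 hH) (hb H hH)
  simp only [Finset.sum_sub_distrib, Finset.sum_add_distrib, ← Finset.sum_div] at hA hB
  have hcostℚ : (∑ i ∈ Finset.range m, ((X \ a i).card : ℚ)) +
      ∑ H ∈ 𝒞, ((insert p H \ b H).card : ℚ) ≤ 3 * κ := by exact_mod_cast hcost
  rw [htotal, hm] at htotal_lt
  have hquarter : ∑ _H ∈ 𝒞, (1 : ℚ) = 3 * κ := by simp [hC]
  rw [hquarter] at hB
  have ite_nonneg (P : Prop) [Decidable P] : (0 : ℚ) ≤ if P then 1 else 0 := by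
    split_ifs <;> norm_num
  have ite_nonneg' (P : Prop) [Decidable P] : (0 : ℚ) ≤ if P then 0 else 1 := by
    split_ifs <;> norm_num
  have hEa := Finset.sum_nonneg fun i (_ : i ∈ Finset.range m) => ite_nonneg (a i = ∅)
  have hEb := Finset.sum_nonneg fun H (_ : H ∈ 𝒞) => ite_nonneg (b H = ∅)
  have hBa := Finset.sum_nonneg fun i (_ : i ∈ Finset.range m) => ite_nonneg' (a i = X)
  have hBb := Finset.sum_nonneg fun H (_ : H ∈ 𝒞) => ite_nonneg' (b H = insert p H ∨ b H = {p})
  have hBa_le : ∀ i ∈ Finset.range m, _ := fun i hi =>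
    Finset.single_le_sum (fun i _ => ite_nonneg' (a i = X)) hi
  have hBb_le : ∀ H ∈ 𝒞, _ := fun H hH =>
    Finset.single_le_sum (fun H _ => ite_nonneg' (b H = insert p H ∨ b H = {p})) hH
  have hsp : score p = ∑ i ∈ Finset.range m, share (a i) p + ∑ H ∈ 𝒞, share (b H) p := rfl
  set Ea := ∑ i ∈ Finset.range m, if a i = ∅ then (1 : ℚ) else 0
  set Eb := ∑ H ∈ 𝒞, if b H = ∅ then (1 : ℚ) else 0
  set Ba := ∑ i ∈ Finset.range m, if a i = X then (0 : ℚ) else 1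
  set Bb := ∑ H ∈ 𝒞, if b H = insert p H ∨ b H = {p} then (0 : ℚ) else 1
  have hs : score p ≤ 3 * κ / 2 - (Ea + Eb) / 4 - (Ba + Bb) / 6 := by linarith
  have hbad : Ba + Bb < 1 := by
    by_contra! h
    nlinarith
  have ha' : ∀ i ∈ Finset.range m, a i = X := by
    intro i hi
    by_contra h
    have := hBa_le i hi
    rw [if_neg h] at this
    linarith
  have hb' : ∀ H ∈ 𝒞, b H = insert p H ∨ b H = {p} := by
    intro H hH
    by_contra h
    have := hBb_le H hH
    rw [if_neg h] at this
    linarith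
  refine hasExactCover_of_covering (Finset.filter_subset (fun H => b H = {p}) 𝒞) h3 ?_ ?_
  · rw [hX]
    refine le_trans ?_ (le_trans (Nat.le_add_left _ _) hcost)
    rw [mul_comm, ← smul_eq_mul, ← Finset.sum_const, Finset.sum_filter]
    refine Finset.sum_le_sum fun H hH => ?_
    split_ifs with h
    · rw [h, Finset.insert_sdiff_of_mem _ (Finset.mem_singleton_self p),
        Finset.sdiff_singleton_eq_erase, Finset.erase_eq_of_notMem (hpH hH), (h3 H hH).2]
    · exact Nat.zero_le _
  · intro x hx
    by_contra! hno
    have hxC : (3 / 4 : ℚ) ≤ ∑ H ∈ 𝒞, share (b H) x := by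
      calc (3 / 4 : ℚ) = ∑ H ∈ 𝒞, if x ∈ H then 1 / 4 else 0 := by
            rw [← Finset.sum_filter, Finset.sum_const, hdeg x hx]
            norm_num
        _ ≤ _ := by
            refine Finset.sum_le_sum fun H hH => ?_
            split_ifs with hxH
            · rcases hb' H hH with h | h
              · rw [h, share_of_mem (Finset.mem_insert_of_mem hxH), hcard4 hH]
                norm_num
              · exact absurd hxH (hno H (Finset.mem_filter.2 ⟨hH, h⟩))
            · exact share_nonneg _ _
    have hxX : ∑ i ∈ Finset.range m, share (a i) x = 3 * κ / 2 - 2 / 3 := by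
      rw [Finset.sum_congr rfl fun i hi => by rw [ha' i hi, share_of_mem hx, hX]]
      rw [Finset.sum_const, Finset.card_range, nsmul_eq_mul, hm]
      push_cast
      field_simp
      ring
    have := hlt x hx
    simp only [hscore] at this hs
    linarith

/-- destructive bribery by at most `3κ` approval deletions under SAV in the
election built from an RX3C instance succeeds iff the instance has an exact cover. -/
theorem appDel_sav_rx3c
    (X : Finset α) (𝒞 : Finset (Finset α)) (κ : ℕ)
    (hκ : 0 < κ) (hκeven : Even κ) (hR : IsRX3C X 𝒞 κ)
    (p : α) (hp : p ∉ X) :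
    (∃ V' : Multiset (Finset α),
        ApprovalDels
          (Multiset.replicate (9 * κ ^ 2 / 2 - 2 * κ) X + 𝒞.val.map (insert p))
          V' (3 * κ) ∧
        ∀ w, IsWinningCommittee (insert p X) 1 (savCom V') w → ∀ x ∈ X, x ∉ w)
    ↔ HasExactCover X 𝒞 := by
  simp_rw [forall_notMem_winning_iff]
  exact ⟨fun ⟨_, hdel, hlt⟩ => hasExactCover_of_forall_lt hκ hκeven hR hp hdel hlt,
    exists_dels_of_hasExactCover hκ hκeven hR hp⟩

end ApprovalBribery
end

section
/- Let (C,V) be an approval election with n = |V| votes, let J ⊆ C be a nonempty set of distinguished candidates with C∖J ≠ ∅, let ℓ be a nonnegative integer, and let r ≥ 1 be an integer. Let s = max_{c∈J} AV(c) and let c* ∈ C∖J be a candidate of maximal AV score among C∖J. Then it is possible to select at most ℓ votes and replace each selected vote v by a vote v' with v ⊆ v' ⊆ C and |v'∖v| ≤ r, so that in the resulting election no candidate of J belongs to any winning 1-committee under AV, if and only if AV(c*) + min{ℓ, n − AV(c*)} ≥ s + 1. -/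
namespace ApprovalBribery

variable {α : Type*} [DecidableEq α]

theorem avScore_eq_countP (V : Multiset (Finset α)) (c : α) :
    avScore V c = V.countP (c ∈ ·) := by
  induction V using Multiset.induction with
  | empty => simp [avScore]
  | cons v V ih =>
    simp only [avScore, Multiset.map_cons, Multiset.sum_cons, Multiset.countP_cons] at ih ⊢
    omega

theorem avScore_add (V W : Multiset (Finset α)) (c : α) :
    avScore (V + W) c = avScore V c + avScore W c := by
  simp [avScore]

theorem avScore_le_card (V : Multiset (Finset α)) (c : α) : avScore V c ≤ V.card := by
  rw [avScore_eq_countP]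
  exact Multiset.countP_le_card _ _

theorem avCom_singleton (V : Multiset (Finset α)) (c : α) : avCom V {c} = avScore V c := by
  unfold avCom avScore
  congr 1
  refine Multiset.map_congr rfl fun v _ => ?_
  by_cases h : c ∈ v <;> simp [h]

/-- The winning 1-committees are the singletons of candidates of maximal AV score. -/
theorem isWinningCommittee_singleton_iff (C : Finset α) (V : Multiset (Finset α)) (c : α) :
    IsWinningCommittee C 1 (avCom V) {c} ↔
      c ∈ C ∧ ∀ d ∈ C, avScore V d ≤ avScore V c := by
  simp only [IsWinningCommittee, Finset.singleton_subset_iff, Finset.card_singleton, true_and,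
    avCom_singleton]
  refine and_congr_right fun _ => ⟨fun h d hd => ?_, fun h w hw hw1 => ?_⟩
  · simpa only [avCom_singleton] using h {d} (by simpa using hd) (by simp)
  · obtain ⟨d, rfl⟩ := Finset.card_eq_one.mp hw1
    rw [avCom_singleton]
    exact h d (by simpa using hw)

/-- No candidate of `J` wins iff some candidate outside `J` beats all of `J`. -/
theorem forall_winning_notMem_iff_s11 {C J : Finset α} (hJC : J ⊆ C) (hC : C.Nonempty)
    (V : Multiset (Finset α)) :
    (∀ w, IsWinningCommittee C 1 (avCom V) w → ∀ c ∈ J, c ∉ w) ↔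
      ∃ d ∈ C \ J, ∀ c ∈ J, avScore V c < avScore V d := by
  constructor
  · intro h
    obtain ⟨d, hd, hdmax⟩ := C.exists_max_image (avScore V) hC
    have key : ∀ c ∈ J, avScore V c < avScore V d := by
      intro c hc
      by_contra! hle
      refine h {c} ?_ c hc (Finset.mem_singleton_self c)
      exact (isWinningCommittee_singleton_iff C V c).mpr
        ⟨hJC hc, fun e he => (hdmax e he).trans hle⟩
    exact ⟨d, Finset.mem_sdiff.mpr ⟨hd, fun hdJ => (key d hdJ).false⟩, key⟩
  · rintro ⟨d, hd, hlt⟩ w hw c hc hcw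
    obtain ⟨e, rfl⟩ := Finset.card_eq_one.mp hw.2.1
    obtain rfl := Finset.mem_singleton.mp hcw
    exact (hlt c hc).not_ge
      (((isWinningCommittee_singleton_iff C V c).mp hw).2 d (Finset.mem_sdiff.mp hd).1)

theorem VoteAdditionChanges.card_eq {C : Finset α} {V V' : Multiset (Finset α)} {ℓ r : ℕ}
    (h : VoteAdditionChanges C V V' ℓ r) : V'.card = V.card := by
  obtain ⟨P, rfl, rfl, -⟩ := h
  simp

theorem VoteAdditionChanges.avScore_le {C : Finset α} {V V' : Multiset (Finset α)} {ℓ r : ℕ}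
    (h : VoteAdditionChanges C V V' ℓ r) (c : α) : avScore V c ≤ avScore V' c := by
  obtain ⟨P, rfl, rfl, hP, -⟩ := h
  simp only [avScore, Multiset.map_map]
  refine Multiset.sum_map_le_sum_map _ _ fun q hq => ?_
  have hsub : q.1 ⊆ q.2 := (hP q hq).elim (fun e => e.subset) (fun h => h.1)
  by_cases hc : c ∈ q.1
  · simp [hc, hsub hc]
  · simp [hc]

theorem VoteAdditionChanges.avScore_le_add {C : Finset α} {V V' : Multiset (Finset α)}
    {ℓ r : ℕ} (h : VoteAdditionChanges C V V' ℓ r) (c : α) :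
    avScore V' c ≤ avScore V c + ℓ := by
  obtain ⟨P, rfl, rfl, -, hℓ⟩ := h
  refine le_trans ?_ (Nat.add_le_add_left hℓ _)
  clear hℓ
  induction P using Multiset.induction with
  | empty => simp [avScore]
  | cons q P ih =>
    simp only [avScore, Multiset.map_cons, Multiset.sum_cons, Multiset.countP_cons] at ih ⊢
    by_cases hq : q.1 = q.2
    · simp only [hq, ne_eq, not_true_eq_false, if_false] at ih ⊢
      omega
    · simp only [hq, ne_eq, not_false_eq_true, if_true] at ih ⊢
      split_ifs <;> omega

/-- A candidate can gain any number `m ≤ ℓ` of approvals, as long as enough votes do not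
approve it, with all other scores unchanged. -/
theorem exists_voteAdditionChanges {C : Finset α} {V : Multiset (Finset α)}
    (hV : ∀ v ∈ V, v ⊆ C) {d : α} (hd : d ∈ C) {ℓ r m : ℕ} (hr : 1 ≤ r) (hmℓ : m ≤ ℓ)
    (hm : m ≤ V.card - avScore V d) :
    ∃ V', VoteAdditionChanges C V V' ℓ r ∧ avScore V' d = avScore V d + m ∧
      ∀ c, c ≠ d → avScore V' c = avScore V c := by
  have hcard : m ≤ (V.filter (d ∉ ·)).card := by
    have h := Multiset.card_eq_countP_add_countP (d ∈ ·) V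
    rw [← avScore_eq_countP] at h
    rw [← Multiset.countP_eq_card_filter]
    omega
  obtain ⟨S, hSm⟩ := Multiset.card_pos_iff_exists_mem.mp
    ((Nat.choose_pos hcard).trans_eq (Multiset.card_powersetCard m _).symm)
  obtain ⟨hS, rfl⟩ := Multiset.mem_powersetCard.mp hSm
  obtain ⟨T, rfl⟩ := Multiset.le_iff_exists_add.mp (hS.trans (Multiset.filter_le _ _))
  have hSd : ∀ v ∈ S, d ∉ v := fun v hv => (Multiset.mem_filter.mp (Multiset.mem_of_le hS hv)).2
  refine ⟨S.map (insert d) + T,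
    ⟨S.map (fun v => (v, insert d v)) + T.map (fun v => (v, v)), ?_, ?_, ?_, ?_⟩, ?_, ?_⟩
  · simp
  · simp
  · intro q hq
    rcases Multiset.mem_add.mp hq with hq | hq <;> obtain ⟨v, hv, rfl⟩ := Multiset.mem_map.mp hq
    · refine Or.inr ⟨Finset.subset_insert _ _, Finset.insert_subset hd
        (hV v (Multiset.mem_add.mpr (Or.inl hv))), ?_⟩
      simpa [Finset.insert_sdiff_of_notMem _ (hSd v hv)] using hr
    · exact Or.inl rfl
  · rw [Multiset.countP_add]
    have hT : (T.map fun v => (v, v)).countP (fun q => q.1 ≠ q.2) = 0 := by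
      simp [Multiset.countP_eq_zero]
    have hS' := Multiset.countP_le_card (fun q : Finset α × Finset α => q.1 ≠ q.2)
      (S.map fun v => (v, insert d v))
    rw [Multiset.card_map] at hS'
    omega
  · have h₀ : avScore S d = 0 := by
      rw [avScore_eq_countP, Multiset.countP_eq_zero]
      exact hSd
    have h₁ : avScore (S.map (insert d)) d = S.card := by
      simp [avScore]
    rw [avScore_add, avScore_add]
    omega
  · intro c hc
    rw [avScore_add, avScore_add]
    simp [avScore, hc]

/-- characterization of destructive bribery with vote addition changes under
AV for `k = 1`. -/
theorem vac_av_k1_characterization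
    (C : Finset α) (V : Multiset (Finset α)) (hV : ∀ v ∈ V, v ⊆ C)
    (J : Finset α) (hJC : J ⊆ C) (hJ : J.Nonempty) (hCJ : (C \ J).Nonempty)
    (ℓ r : ℕ) (hr : 1 ≤ r)
    (cstar : α) (hcs : cstar ∈ C \ J)
    (hmax : ∀ c ∈ C \ J, avScore V c ≤ avScore V cstar) :
    (∃ V' : Multiset (Finset α), VoteAdditionChanges C V V' ℓ r ∧
        ∀ w, IsWinningCommittee C 1 (avCom V') w → ∀ c ∈ J, c ∉ w)
    ↔ J.sup' hJ (avScore V) + 1 ≤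
        avScore V cstar + min ℓ (Multiset.card V - avScore V cstar) := by
  have hC : C.Nonempty := hCJ.mono Finset.sdiff_subset
  simp only [forall_winning_notMem_iff_s11 hJC hC]
  have hn := avScore_le_card V cstar
  constructor
  · rintro ⟨V', hV', d, hd, hlt⟩
    obtain ⟨j, hj, hsup⟩ := Finset.exists_mem_eq_sup' hJ (avScore V)
    have h₁ := hV'.avScore_le j
    have h₂ := hlt j hj
    have h₃ := hV'.avScore_le_add d
    have h₄ := hmax d hd
    have h₅ := avScore_le_card V' d
    rw [hV'.card_eq] at h₅
    omega
  · intro h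
    obtain ⟨V', hV', hs, hne⟩ := exists_voteAdditionChanges hV (Finset.mem_sdiff.mp hcs).1 hr
      (min_le_left ℓ (V.card - avScore V cstar)) (min_le_right _ _)
    refine ⟨V', hV', cstar, hcs, fun c hc => ?_⟩
    have hcne : c ≠ cstar := fun e => (Finset.mem_sdiff.mp hcs).2 (e ▸ hc)
    have := Finset.le_sup' (avScore V) hc
    rw [hne c hcne, hs]
    omega

end ApprovalBribery
end
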